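/- arXiv:2202.02622 — 2 statements merged into one kernel-verified Lean document; each statement's English description precedes it below -/
import Mathlib

section
/- On ℝ² with the Euclidean cometric g, the Poisson bivector Π ∂₁∧∂₂ and the associated contravariant Levi-Civita connection D, for every smooth 1-form η one has Δ^D(−(1/2)g(η,η)) = |Dη|² − g(Δ^Dη, η), where Δ^D is the contravariant Laplacian and |Dη|² = Σ_{i=1,2} g(D_{dxⁱ}η, D_{dxⁱ}η). -/
noncomputable section

/-- Smooth scalar functions on `ℝ²`. -/
abbrev Fn : Type := (ℝ × ℝ) → ℝ

/-- A 1-form on `ℝ²` identified with its pair of component functions. -/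
abbrev OneForm : Type := Fn × Fn

/-- Partial derivative in the first coordinate direction. -/
def pd1 (f : Fn) : Fn := fun p => fderiv ℝ f p (1, 0)

/-- Partial derivative in the second coordinate direction. -/
def pd2 (f : Fn) : Fn := fun p => fderiv ℝ f p (0, 1)

/-- Smoothness of a function. -/
def SmoothFn (f : Fn) : Prop := ContDiff ℝ (⊤ : ℕ∞) f

/-- Smoothness of a 1-form. -/
def SmoothForm (ω : OneForm) : Prop := SmoothFn ω.1 ∧ SmoothFn ω.2

/-- The Euclidean cometric on 1-forms. -/
def gmet (ω τ : OneForm) : Fn := fun p => ω.1 p * τ.1 p + ω.2 p * τ.2 p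

/-- The sharp map `♯(ω)` acting on a function. -/
def sharpF (Pi : Fn) (ω : OneForm) (f : Fn) : Fn :=
  fun p => Pi p * (ω.1 p * pd2 f p - ω.2 p * pd1 f p)

/-- The contravariant Levi-Civita connection associated with `(g, Π)`. -/
def Dconn (Pi : Fn) (ω τ : OneForm) : OneForm :=
  (fun p => sharpF Pi ω τ.1 p + (ω.1 p * pd1 Pi p + ω.2 p * pd2 Pi p) * τ.2 p,
   fun p => sharpF Pi ω τ.2 p - (ω.1 p * pd1 Pi p + ω.2 p * pd2 Pi p) * τ.1 p)

/-- The sharp map as a vector field `(X¹, X²)`. -/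
def sharpVF (Pi : Fn) (ω : OneForm) : Fn × Fn :=
  (fun p => -(Pi p) * ω.2 p, fun p => Pi p * ω.1 p)

/-- Lie derivative of a 1-form along a vector field. -/
def lieVF (X : Fn × Fn) (τ : OneForm) : OneForm :=
  (fun p => X.1 p * pd1 τ.1 p + X.2 p * pd2 τ.1 p + τ.1 p * pd1 X.1 p + τ.2 p * pd1 X.2 p,
   fun p => X.1 p * pd1 τ.2 p + X.2 p * pd2 τ.2 p + τ.1 p * pd2 X.1 p + τ.2 p * pd2 X.2 p)

/-- The bivector evaluated on two 1-forms: `Π(ω,τ) = Π·(ω₁τ₂ − ω₂τ₁)`. -/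
def PiForm (Pi : Fn) (ω τ : OneForm) : Fn :=
  fun p => Pi p * (ω.1 p * τ.2 p - ω.2 p * τ.1 p)

/-- The exterior differential of a function, as a 1-form. -/
def dF (f : Fn) : OneForm := (pd1 f, pd2 f)

/-- The Koszul bracket of 1-forms. -/
def koszul (Pi : Fn) (ω τ : OneForm) : OneForm :=
  lieVF (sharpVF Pi ω) τ - lieVF (sharpVF Pi τ) ω - dF (PiForm Pi ω τ)

/-- Lie derivative of the cometric `g` along a 1-form `η`. -/
def lieG (Pi : Fn) (η α β : OneForm) : Fn :=
  fun p => sharpF Pi η (gmet α β) p - gmet (koszul Pi η α) β p - gmet α (koszul Pi η β) p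

/-- Second Lie derivative `(L_η (L_η g))(α, β)`. -/
def lie2G (Pi : Fn) (η α β : OneForm) : Fn :=
  fun p => sharpF Pi η (lieG Pi η α β) p - lieG Pi η (koszul Pi η α) β p
    - lieG Pi η α (koszul Pi η β) p

/-- `η` is a Killing 1-form. -/
def IsKilling (Pi : Fn) (η : OneForm) : Prop :=
  ∀ α β : OneForm, SmoothForm α → SmoothForm β → lieG Pi η α β = 0

/-- `η` is a 2-Killing 1-form. -/
def Is2Killing (Pi : Fn) (η : OneForm) : Prop :=
  ∀ α β : OneForm, SmoothForm α → SmoothForm β → lie2G Pi η α β = 0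

/-- Curvature of the contravariant connection. -/
def curv (Pi : Fn) (ω τ γ : OneForm) : OneForm :=
  Dconn Pi ω (Dconn Pi τ γ) - Dconn Pi τ (Dconn Pi ω γ) - Dconn Pi (koszul Pi ω τ) γ

/-- The coordinate 1-form `dx¹`. -/
def dx1 : OneForm := (fun _ => 1, fun _ => 0)

/-- The coordinate 1-form `dx²`. -/
def dx2 : OneForm := (fun _ => 0, fun _ => 1)

/-- Contravariant Laplacian on functions. -/
def lapF (Pi : Fn) (f : Fn) : Fn :=
  fun p => -((sharpF Pi dx1 (sharpF Pi dx1 f) p - sharpF Pi (Dconn Pi dx1 dx1) f p)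
    + (sharpF Pi dx2 (sharpF Pi dx2 f) p - sharpF Pi (Dconn Pi dx2 dx2) f p))

/-- Contravariant Laplacian on 1-forms. -/
def lapO (Pi : Fn) (η : OneForm) : OneForm :=
  -((Dconn Pi dx1 (Dconn Pi dx1 η) - Dconn Pi (Dconn Pi dx1 dx1) η)
    + (Dconn Pi dx2 (Dconn Pi dx2 η) - Dconn Pi (Dconn Pi dx2 dx2) η))

theorem SmoothFn.differentiable {f : Fn} (hf : SmoothFn f) : Differentiable ℝ f :=
  ContDiff.differentiable hf (by simp)

theorem SmoothForm.differentiable {ω : OneForm} (hω : SmoothForm ω) :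
    Differentiable ℝ ω.1 ∧ Differentiable ℝ ω.2 :=
  ⟨hω.1.differentiable, hω.2.differentiable⟩

theorem SmoothFn.pd1 {f : Fn} (hf : SmoothFn f) : SmoothFn (pd1 f) :=
  (ContDiff.fderiv_right hf le_rfl).clm_apply contDiff_const

theorem SmoothFn.pd2 {f : Fn} (hf : SmoothFn f) : SmoothFn (pd2 f) :=
  (ContDiff.fderiv_right hf le_rfl).clm_apply contDiff_const

theorem SmoothFn.sharpF {Pi f : Fn} {ω : OneForm} (hPi : SmoothFn Pi) (hω : SmoothForm ω)
    (hf : SmoothFn f) : SmoothFn (sharpF Pi ω f) :=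
  ContDiff.mul hPi ((ContDiff.mul hω.1 hf.pd2).sub (ContDiff.mul hω.2 hf.pd1))

theorem SmoothForm.dconn {Pi : Fn} {ω τ : OneForm} (hω : SmoothForm ω) (hPi : SmoothFn Pi)
    (hτ : SmoothForm τ) : SmoothForm (Dconn Pi ω τ) := by
  have h := (ContDiff.mul hω.1 hPi.pd1).add (ContDiff.mul hω.2 hPi.pd2)
  exact ⟨ContDiff.add (hPi.sharpF hω hτ.1) (h.mul hτ.2),
    ContDiff.sub (hPi.sharpF hω hτ.2) (h.mul hτ.1)⟩

/-- The contravariant connection is compatible with the cometric. -/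
theorem sharpF_const_mul_gmet (Pi : Fn) (c : ℝ) (ω : OneForm) {α β : OneForm}
    (hα : Differentiable ℝ α.1 ∧ Differentiable ℝ α.2)
    (hβ : Differentiable ℝ β.1 ∧ Differentiable ℝ β.2) :
    sharpF Pi ω (fun p => c * gmet α β p) =
      fun p => c * (gmet (Dconn Pi ω α) β p + gmet α (Dconn Pi ω β) p) := by
  funext p
  have key : HasFDerivAt (fun p => c * gmet α β p)
      (c • ((α.1 p • fderiv ℝ β.1 p + β.1 p • fderiv ℝ α.1 p) +
        (α.2 p • fderiv ℝ β.2 p + β.2 p • fderiv ℝ α.2 p))) p :=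
    (((hα.1 p).hasFDerivAt.mul (hβ.1 p).hasFDerivAt).add
      ((hα.2 p).hasFDerivAt.mul (hβ.2 p).hasFDerivAt)).const_mul c
  simp only [sharpF, pd1, pd2, key.fderiv]
  simp only [gmet, Dconn, sharpF, pd1, pd2, add_apply, smul_apply, smul_eq_mul]
  ring

theorem smoothForm_dx1 : SmoothForm dx1 := ⟨contDiff_const, contDiff_const⟩

theorem smoothForm_dx2 : SmoothForm dx2 := ⟨contDiff_const, contDiff_const⟩

theorem gmet_comm (ω τ : OneForm) : gmet ω τ = gmet τ ω := by
  funext p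
  simp only [gmet]
  ring

theorem sharpF_neg_half_gmet_self (Pi : Fn) (ω : OneForm) {η : OneForm}
    (hη : Differentiable ℝ η.1 ∧ Differentiable ℝ η.2) :
    sharpF Pi ω (fun p => -(1 / 2) * gmet η η p) = fun p => -1 * gmet (Dconn Pi ω η) η p := by
  rw [sharpF_const_mul_gmet Pi _ ω hη hη, gmet_comm η]
  funext p
  ring

theorem bochner_laplacian_formula (Pi : Fn) (hPi : SmoothFn Pi)
    (η : OneForm) (hη : SmoothForm η) :
    lapF Pi (fun p => -(1 / 2) * gmet η η p)
      = fun p => (gmet (Dconn Pi dx1 η) (Dconn Pi dx1 η) p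
            + gmet (Dconn Pi dx2 η) (Dconn Pi dx2 η) p)
          - gmet (lapO Pi η) η p := by
  have hη' := hη.differentiable
  funext p
  simp only [lapF, sharpF_neg_half_gmet_self Pi _ hη']
  rw [sharpF_const_mul_gmet Pi _ _ (smoothForm_dx1.dconn hPi hη).differentiable hη',
    sharpF_const_mul_gmet Pi _ _ (smoothForm_dx2.dconn hPi hη).differentiable hη']
  simp only [gmet, lapO, Prod.fst_neg, Prod.snd_neg, Prod.fst_add, Prod.snd_add, Prod.fst_sub,
    Prod.snd_sub, _root_.Pi.neg_apply, _root_.Pi.add_apply,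
    _root_.Pi.sub_apply]
  ring

end
end

section
/- On ℝ² with the Euclidean cometric g, the Poisson bivector Π ∂₁∧∂₂ and the associated contravariant Levi-Civita connection D with curvature R, if a smooth 1-form η is a 2-Killing 1-form and D_ηη = 0, then Ric(η,η) = |Dη|², where Ric(ω,τ) = Σ_{i=1,2} g(R(ω,dxⁱ)dxⁱ, τ) and |Dη|² = Σ_{i=1,2} g(D_{dxⁱ}η, D_{dxⁱ}η). -/
noncomputable section

theorem SmoothFn.add {f g : Fn} (hf : SmoothFn f) (hg : SmoothFn g) : SmoothFn (f + g) :=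
  ContDiff.add hf hg

theorem SmoothFn.sub {f g : Fn} (hf : SmoothFn f) (hg : SmoothFn g) : SmoothFn (f - g) :=
  ContDiff.sub hf hg

theorem SmoothFn.mul {f g : Fn} (hf : SmoothFn f) (hg : SmoothFn g) : SmoothFn (f * g) :=
  ContDiff.mul hf hg

theorem SmoothFn.neg {f : Fn} (hf : SmoothFn f) : SmoothFn (-f) :=
  ContDiff.neg hf

theorem SmoothFn.zero : SmoothFn 0 := contDiff_const

theorem SmoothFn.one : SmoothFn 1 := contDiff_const

theorem SmoothFn.fderiv_apply {f : Fn} (hf : SmoothFn f) (v : ℝ × ℝ) :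
    SmoothFn fun p => fderiv ℝ f p v :=
  (ContDiff.fderiv_right hf (m := (⊤ : ℕ∞)) (by simp)).clm_apply contDiff_const

theorem SmoothFn.differentiableAt {f : Fn} (hf : SmoothFn f) (p : ℝ × ℝ) :
    DifferentiableAt ℝ f p :=
  (ContDiff.differentiable hf (by simp)).differentiableAt

theorem pd1_add {f g : Fn} (hf : SmoothFn f) (hg : SmoothFn g) :
    pd1 (f + g) = pd1 f + pd1 g := by
  funext p
  simp [pd1, fderiv_add (hf.differentiableAt p) (hg.differentiableAt p)]

theorem pd2_add {f g : Fn} (hf : SmoothFn f) (hg : SmoothFn g) :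
    pd2 (f + g) = pd2 f + pd2 g := by
  funext p
  simp [pd2, fderiv_add (hf.differentiableAt p) (hg.differentiableAt p)]

theorem pd1_sub {f g : Fn} (hf : SmoothFn f) (hg : SmoothFn g) :
    pd1 (f - g) = pd1 f - pd1 g := by
  funext p
  simp [pd1, fderiv_sub (hf.differentiableAt p) (hg.differentiableAt p)]

theorem pd2_sub {f g : Fn} (hf : SmoothFn f) (hg : SmoothFn g) :
    pd2 (f - g) = pd2 f - pd2 g := by
  funext p
  simp [pd2, fderiv_sub (hf.differentiableAt p) (hg.differentiableAt p)]

theorem pd1_mul {f g : Fn} (hf : SmoothFn f) (hg : SmoothFn g) :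
    pd1 (f * g) = f * pd1 g + g * pd1 f := by
  funext p
  simp [pd1, fderiv_mul (hf.differentiableAt p) (hg.differentiableAt p)]

theorem pd2_mul {f g : Fn} (hf : SmoothFn f) (hg : SmoothFn g) :
    pd2 (f * g) = f * pd2 g + g * pd2 f := by
  funext p
  simp [pd2, fderiv_mul (hf.differentiableAt p) (hg.differentiableAt p)]

theorem pd1_neg (f : Fn) : pd1 (-f) = -pd1 f := by
  funext p
  simp [pd1, fderiv_neg]

theorem pd2_neg (f : Fn) : pd2 (-f) = -pd2 f := by
  funext p
  simp [pd2, fderiv_neg]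

theorem pd1_zero : pd1 0 = 0 := by
  funext p
  simp [pd1]

theorem pd2_zero : pd2 0 = 0 := by
  funext p
  simp [pd2]

theorem pd1_one : pd1 1 = 0 := by
  funext p
  simp [pd1]

theorem pd2_one : pd2 1 = 0 := by
  funext p
  simp [pd2]

theorem pd2_pd1 {f : Fn} (hf : SmoothFn f) : pd2 (pd1 f) = pd1 (pd2 f) := by
  funext p
  have hd : DifferentiableAt ℝ (fderiv ℝ f) p :=
    ((ContDiff.fderiv_right hf (m := 1) (by norm_cast)).differentiable one_ne_zero).differentiableAt
  have hs : IsSymmSndFDerivAt ℝ f p :=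
    (ContDiff.contDiffAt hf).isSymmSndFDerivAt (by simp; norm_cast)
  have h (v w : ℝ × ℝ) :
      fderiv ℝ (fun q => fderiv ℝ f q v) p w = fderiv ℝ (fderiv ℝ f) p w v := by
    simp [fderiv_clm_apply hd (differentiableAt_const v)]
  unfold pd1 pd2
  rw [h, h, hs.eq]

theorem gmet_eq (ω τ : OneForm) : gmet ω τ = ω.1 * τ.1 + ω.2 * τ.2 := rfl

theorem sharpF_eq (Pi : Fn) (ω : OneForm) (f : Fn) :
    sharpF Pi ω f = Pi * (ω.1 * pd2 f - ω.2 * pd1 f) := rfl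

theorem Dconn_eq (Pi : Fn) (ω τ : OneForm) :
    Dconn Pi ω τ =
      (sharpF Pi ω τ.1 + (ω.1 * pd1 Pi + ω.2 * pd2 Pi) * τ.2,
       sharpF Pi ω τ.2 - (ω.1 * pd1 Pi + ω.2 * pd2 Pi) * τ.1) := rfl

theorem lieVF_eq (X : Fn × Fn) (τ : OneForm) :
    lieVF X τ =
      (X.1 * pd1 τ.1 + X.2 * pd2 τ.1 + τ.1 * pd1 X.1 + τ.2 * pd1 X.2,
       X.1 * pd1 τ.2 + X.2 * pd2 τ.2 + τ.1 * pd2 X.1 + τ.2 * pd2 X.2) := rfl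

theorem sharpVF_eq (Pi : Fn) (ω : OneForm) : sharpVF Pi ω = (-Pi * ω.2, Pi * ω.1) := rfl

theorem PiForm_eq (Pi : Fn) (ω τ : OneForm) :
    PiForm Pi ω τ = Pi * (ω.1 * τ.2 - ω.2 * τ.1) := rfl

theorem dx1_eq : dx1 = (1, 0) := rfl

theorem dx2_eq : dx2 = (0, 1) := rfl

theorem lieG_eq (Pi : Fn) (η α β : OneForm) :
    lieG Pi η α β =
      sharpF Pi η (gmet α β) - gmet (koszul Pi η α) β - gmet α (koszul Pi η β) := rfl

theorem lie2G_eq (Pi : Fn) (η α β : OneForm) :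
    lie2G Pi η α β =
      sharpF Pi η (lieG Pi η α β) - lieG Pi η (koszul Pi η α) β
        - lieG Pi η α (koszul Pi η β) := rfl

/-- The contravariant connection is torsion-free. -/
theorem koszul_eq_Dconn_sub_Dconn {Pi : Fn} (hPi : SmoothFn Pi) {ω τ : OneForm}
    (hω : SmoothForm ω) (hτ : SmoothForm τ) :
    koszul Pi ω τ = Dconn Pi ω τ - Dconn Pi τ ω := by
  obtain ⟨hω₁, hω₂⟩ := hω
  obtain ⟨hτ₁, hτ₂⟩ := hτ
  ext1 <;>
  · simp (maxDischargeDepth := 20) only [koszul, dF, lieVF_eq, sharpVF_eq, PiForm_eq, Dconn_eq, sharpF_eq, Prod.fst_sub,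
      Prod.snd_sub, pd1_mul, pd2_mul, pd1_sub, pd2_sub, pd1_neg, pd2_neg, SmoothFn.mul,
      SmoothFn.sub, SmoothFn.neg, hPi, hω₁, hω₂, hτ₁, hτ₂]
    ring

theorem SmoothForm.sub {ω τ : OneForm} (hω : SmoothForm ω) (hτ : SmoothForm τ) :
    SmoothForm (ω - τ) :=
  ⟨hω.1.sub hτ.1, hω.2.sub hτ.2⟩

theorem SmoothForm.Dconn {Pi : Fn} {ω τ : OneForm} (hPi : SmoothFn Pi) (hω : SmoothForm ω)
    (hτ : SmoothForm τ) : SmoothForm (Dconn Pi ω τ) :=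
  have h := (hω.1.mul hPi.pd1).add (hω.2.mul hPi.pd2)
  ⟨(hPi.sharpF hω hτ.1).add (h.mul hτ.2), (hPi.sharpF hω hτ.2).sub (h.mul hτ.1)⟩

/-- Trace of the second Lie derivative of the cometric in terms of `|Dη|²`, `Ric(η, η)` and the
divergence of `D_η η`. -/
theorem lie2G_trace {Pi : Fn} (hPi : SmoothFn Pi) {η : OneForm} (hη : SmoothForm η) :
    lie2G Pi η dx1 dx1 + lie2G Pi η dx2 dx2 =
      2 * (gmet (Dconn Pi dx1 η) (Dconn Pi dx1 η) + gmet (Dconn Pi dx2 η) (Dconn Pi dx2 η)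
        - (gmet (curv Pi η dx1 dx1) η + gmet (curv Pi η dx2 dx2) η)
        + (gmet (Dconn Pi dx1 (Dconn Pi η η)) dx1 + gmet (Dconn Pi dx2 (Dconn Pi η η)) dx2)) := by
  have h₁ := koszul_eq_Dconn_sub_Dconn hPi hη smoothForm_dx1
  have h₂ := koszul_eq_Dconn_sub_Dconn hPi hη smoothForm_dx2
  have h₁₁ := koszul_eq_Dconn_sub_Dconn hPi hη
    ((SmoothForm.Dconn hPi hη smoothForm_dx1).sub (SmoothForm.Dconn hPi smoothForm_dx1 hη))
  have h₂₂ := koszul_eq_Dconn_sub_Dconn hPi hη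
    ((SmoothForm.Dconn hPi hη smoothForm_dx2).sub (SmoothForm.Dconn hPi smoothForm_dx2 hη))
  obtain ⟨hη₁, hη₂⟩ := hη
  simp only [lie2G_eq, lieG_eq, curv, h₁, h₂, h₁₁, h₂₂]
  simp (maxDischargeDepth := 20) only [Dconn_eq, sharpF_eq, gmet_eq, dx1_eq, dx2_eq, Prod.fst_sub, Prod.snd_sub,
    mul_zero, zero_mul, mul_one, one_mul, add_zero, zero_add, sub_zero, zero_sub,
    pd1_zero, pd2_zero, pd1_one, pd2_one, pd1_add, pd2_add, pd1_mul, pd2_mul, pd1_sub, pd2_sub,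
    pd1_neg, pd2_neg, pd2_pd1, SmoothFn.add, SmoothFn.mul, SmoothFn.sub, SmoothFn.neg,
    SmoothFn.pd1, SmoothFn.pd2, hPi, hη₁, hη₂]
  ring

theorem two_killing_ricci_eq_norm (Pi : Fn) (hPi : SmoothFn Pi)
    (η : OneForm) (hη : SmoothForm η) (h2K : Is2Killing Pi η)
    (hD : Dconn Pi η η = 0) :
    ∀ p : ℝ × ℝ,
      gmet (curv Pi η dx1 dx1) η p + gmet (curv Pi η dx2 dx2) η p
        = gmet (Dconn Pi dx1 η) (Dconn Pi dx1 η) p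
          + gmet (Dconn Pi dx2 η) (Dconn Pi dx2 η) p := by
  intro p
  have h := congrFun (lie2G_trace hPi hη) p
  have h0 (ω : OneForm) : Dconn Pi ω 0 = 0 := by
    simp [Dconn_eq, sharpF_eq, pd1_zero, pd2_zero]
  rw [h2K _ _ smoothForm_dx1 smoothForm_dx1, h2K _ _ smoothForm_dx2 smoothForm_dx2, hD, h0, h0] at h
  simp only [_root_.Pi.add_apply, _root_.Pi.sub_apply, _root_.Pi.mul_apply,
    _root_.Pi.ofNat_apply] at h
  have hz (ω : OneForm) : gmet 0 ω p = 0 := by simp [gmet]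
  rw [hz, hz] at h
  linarith

end
end
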